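/- arXiv:2510.06521 — 4 statements merged into one kernel-verified Lean document; each statement's English description precedes it below -/
import Mathlib

section
/- Let 1 ≤ a ≤ k. In the ring of formal power series ℚ[[x,q]] in two variables, the generating function P_{k,a}(x,q) = Σ_{n≥k} Σ_{π ∈ P_{n,k}} x^n q^{srec_a(π)} satisfies P_{k,a}(x,q) = x^k · q^{a(a−1)/2} · ∏_{j=1}^{a−1} (1 − x·q·(1 + q + ⋯ + q^{j−1}))^{−1} · ∏_{i=a}^{k} (1 − i·x)^{−1}, where each factor being inverted has constant term 1 and hence is a unit of ℚ[[x,q]]. -/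
open Finset PowerSeries

/-- Restricted growth condition (canonical sequential form of a set partition):
each entry is positive and at most one more than the maximum of the preceding entries
(so the first entry is `1`). -/
def IsRGW {n : ℕ} (π : Fin n → ℕ) : Prop :=
  ∀ i : Fin n, 1 ≤ π i ∧ π i ≤ (Finset.univ.filter (fun j => j < i)).sup π + 1

instance {n : ℕ} (π : Fin n → ℕ) : Decidable (IsRGW π) := by
  unfold IsRGW; infer_instance

/-- `Pnk n k` : the canonical sequential forms of set partitions of `[n]` with exactly
`k` blocks (restricted growth words of length `n` with maximum value `k`);
every such word has entries `≤ n`, so they are all captured as images of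
functions `Fin n → Fin (n+1)`. -/
def Pnk (n k : ℕ) : Finset (Fin n → ℕ) :=
  ((Finset.univ : Finset (Fin n → Fin (n+1))).filter
      (fun π => IsRGW (fun i => (π i : ℕ)) ∧ Finset.univ.sup (fun i => (π i : ℕ)) = k)).image
    (fun π i => (π i : ℕ))

/-- `Pall n` : the canonical sequential forms of all set partitions of `[n]`. -/
def Pall (n : ℕ) : Finset (Fin n → ℕ) :=
  ((Finset.univ : Finset (Fin n → Fin (n+1))).filter
      (fun π => IsRGW (fun i => (π i : ℕ)))).image (fun π i => (π i : ℕ))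

/-- `sreca π a` : the sum of the entries of `π` strictly preceding the position of the
first occurrence of the (record) value `a`: an index `i` precedes that position
iff no `j ≤ i` satisfies `π j = a`. -/
def sreca {n : ℕ} (π : Fin n → ℕ) (a : ℕ) : ℕ :=
  ∑ i ∈ Finset.univ.filter (fun i : Fin n => ∀ j, j ≤ i → π j ≠ a), π i

/-- `srec π` : the sum of `sreca π a` over all record values `a` of `π`
(for a restricted growth word the record values are exactly `1, …, max π`). -/
def srec {n : ℕ} (π : Fin n → ℕ) : ℕ :=
  ∑ a ∈ Finset.Icc 1 (Finset.univ.sup π), sreca π a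

/-- Stirling numbers of the second kind `S_{n,k}`. -/
def stirling2 : ℕ → ℕ → ℕ
  | 0, 0 => 1
  | 0, _ + 1 => 0
  | _ + 1, 0 => 0
  | n + 1, k + 1 => stirling2 n k + (k + 1) * stirling2 n (k + 1)

/-- Bell numbers `B_n`. -/
def bell (n : ℕ) : ℕ := ∑ k ∈ Finset.range (n + 1), stirling2 n k

/-- The formal power series `exp(cx) = Σ_{n≥0} c^n x^n / n!` in `ℚ[[x]]`. -/
noncomputable def expc (c : ℚ) : PowerSeries ℚ :=
  PowerSeries.mk fun n => c ^ n / n.factorial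

/-- The formal exponential `exp(f) = Σ_{m≥0} f^m/m!` of a power series `f` with zero
constant term (then `coeff n (f^m) = 0` for `m > n`, so the truncated sum below is the
full sum). In particular `psExp (expc 1 - 1)` is `exp(exp(x) - 1)`. -/
noncomputable def psExp (f : PowerSeries ℚ) : PowerSeries ℚ :=
  PowerSeries.mk fun n =>
    ∑ m ∈ Finset.range (n + 1), (PowerSeries.coeff n (f ^ m)) / m.factorial

lemma rg_sup_snoc {n : ℕ} (π : Fin n → ℕ) (c : ℕ) :
    (Finset.univ : Finset (Fin (n+1))).sup (Fin.snoc π c : Fin (n+1) → ℕ)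
      = max (Finset.univ.sup π) c := by
  apply eq_of_forall_ge_iff
  intro m
  simp [Finset.sup_le_iff, Fin.forall_fin_succ']

lemma rg_sup_lt_castSucc {n : ℕ} (π : Fin n → ℕ) (c : ℕ) (i : Fin n) :
    ((Finset.univ : Finset (Fin (n+1))).filter (fun j => j < i.castSucc)).sup
      (Fin.snoc π c : Fin (n+1) → ℕ)
      = (Finset.univ.filter (fun j => j < i)).sup π := by
  apply eq_of_forall_ge_iff
  intro m
  have h : ¬ (Fin.last n < i.castSucc) := not_lt.2 (Fin.le_last _)
  simp [Finset.sup_le_iff, Fin.forall_fin_succ', h]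

lemma rg_sup_lt_last {n : ℕ} (π : Fin n → ℕ) (c : ℕ) :
    ((Finset.univ : Finset (Fin (n+1))).filter (fun j => j < Fin.last n)).sup
      (Fin.snoc π c : Fin (n+1) → ℕ) = Finset.univ.sup π := by
  apply eq_of_forall_ge_iff
  intro m
  simp [Finset.sup_le_iff, Fin.forall_fin_succ', Fin.castSucc_lt_last]

lemma rg_snoc {n : ℕ} (π : Fin n → ℕ) (c : ℕ) :
    IsRGW (Fin.snoc π c : Fin (n+1) → ℕ) ↔
      IsRGW π ∧ 1 ≤ c ∧ c ≤ Finset.univ.sup π + 1 := by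
  unfold IsRGW
  rw [Fin.forall_fin_succ']
  simp only [rg_sup_lt_castSucc, rg_sup_lt_last, Fin.snoc_castSucc, Fin.snoc_last]

lemma rg_sup_le : ∀ {n : ℕ} (π : Fin n → ℕ), IsRGW π → Finset.univ.sup π ≤ n := by
  intro n
  induction n with
  | zero => intro π _; simp
  | succ n ih =>
    intro π h
    rw [← Fin.snoc_init_self π] at h ⊢
    rw [rg_snoc] at h
    rw [rg_sup_snoc]
    have := ih _ h.1
    omega

lemma rg_mem_iff : ∀ {n : ℕ} (π : Fin n → ℕ) (a : ℕ), IsRGW π → 1 ≤ a →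
    ((∀ j, π j ≠ a) ↔ Finset.univ.sup π < a) := by
  intro n
  induction n with
  | zero => intro π a _ h; simp; omega
  | succ n ih =>
    intro π a h ha
    rw [← Fin.snoc_init_self π] at h ⊢
    rw [rg_snoc] at h
    rw [rg_sup_snoc, Fin.forall_fin_succ']
    simp only [Fin.snoc_castSucc, Fin.snoc_last]
    rw [ih _ a h.1 ha]
    omega

lemma mem_Pnk' {n k : ℕ} (π : Fin n → ℕ) :
    π ∈ Pnk n k ↔ IsRGW π ∧ Finset.univ.sup π = k := by
  unfold Pnk
  simp only [Finset.mem_image, Finset.mem_filter, Finset.mem_univ, true_and]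
  constructor
  · rintro ⟨σ, h, rfl⟩; exact h
  · intro h
    refine ⟨fun i => ⟨π i, ?_⟩, h, rfl⟩
    have h1 := rg_sup_le π h.1
    have h2 : π i ≤ Finset.univ.sup π := Finset.le_sup (Finset.mem_univ i)
    omega

lemma sreca_snoc {n : ℕ} (π : Fin n → ℕ) (c a : ℕ) :
    sreca (Fin.snoc π c : Fin (n+1) → ℕ) a
      = sreca π a + if (∀ j, π j ≠ a) ∧ c ≠ a then c else 0 := by
  unfold sreca
  rw [Finset.sum_filter, Finset.sum_filter, Fin.sum_univ_castSucc]
  have h : ∀ i : Fin n, ¬ (Fin.last n ≤ i.castSucc) := fun i => not_le.2 (Fin.castSucc_lt_last i)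
  simp [Fin.forall_fin_succ', h, Fin.le_last]

lemma sum_Pnk_succ {n k : ℕ} (f : (Fin (n+1) → ℕ) → ℕ) :
    ∑ π ∈ Pnk (n+1) (k+1), f π =
      ∑ π ∈ Pnk n k, f (Fin.snoc π (k+1) : Fin (n+1) → ℕ) +
      ∑ c ∈ Finset.Icc 1 (k+1), ∑ π ∈ Pnk n (k+1), f (Fin.snoc π c : Fin (n+1) → ℕ) := by
  classical
  rw [← Finset.sum_filter_add_sum_filter_not (Pnk (n+1) (k+1))
    (fun π => Finset.univ.sup (Fin.init π : Fin n → ℕ) = k)]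
  congr 1
  · refine Finset.sum_bij' (fun π _ => Fin.init π)
      (fun π _ => (Fin.snoc π (k+1) : Fin (n+1) → ℕ)) ?_ ?_ ?_ ?_ ?_
    · intro π h
      rw [Finset.mem_filter, mem_Pnk', ← Fin.snoc_init_self π, rg_snoc] at h
      rw [mem_Pnk']
      simp only [Fin.init_snoc] at h
      exact ⟨h.1.1.1, h.2⟩
    · intro π h
      rw [mem_Pnk'] at h
      rw [Finset.mem_filter, mem_Pnk', rg_snoc, rg_sup_snoc, Fin.init_snoc, h.2]
      refine ⟨⟨⟨h.1, ?_, ?_⟩, ?_⟩, rfl⟩ <;> omega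
    · intro π h
      have h' := h
      rw [Finset.mem_filter, mem_Pnk', ← Fin.snoc_init_self π, rg_snoc, rg_sup_snoc] at h'
      simp only [Fin.init_snoc] at h'
      have : π (Fin.last n) = k + 1 := by omega
      conv_rhs => rw [← Fin.snoc_init_self π]
      rw [this]
    · intro π h; simp
    · intro π h
      have h' := h
      rw [Finset.mem_filter, mem_Pnk', ← Fin.snoc_init_self π, rg_snoc, rg_sup_snoc] at h'
      simp only [Fin.init_snoc] at h'
      have : π (Fin.last n) = k + 1 := by omega
      conv_lhs => rw [← Fin.snoc_init_self π]
      rw [this]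
  · rw [← Finset.sum_product']
    refine Finset.sum_bij' (fun π _ => (π (Fin.last n), (Fin.init π : Fin n → ℕ)))
      (fun p _ => (Fin.snoc p.2 p.1 : Fin (n+1) → ℕ)) ?_ ?_ ?_ ?_ ?_
    · intro π h
      rw [Finset.mem_filter, mem_Pnk', ← Fin.snoc_init_self π, rg_snoc, rg_sup_snoc] at h
      simp only [Fin.init_snoc] at h
      rw [Finset.mem_product, Finset.mem_Icc, mem_Pnk']
      refine ⟨⟨?_, ?_⟩, h.1.1.1, ?_⟩ <;> dsimp only <;> omega
    · rintro ⟨c, π⟩ h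
      rw [Finset.mem_product, Finset.mem_Icc, mem_Pnk'] at h
      dsimp only at h
      rw [Finset.mem_filter, mem_Pnk', rg_snoc, rg_sup_snoc, Fin.init_snoc, h.2.2]
      refine ⟨⟨⟨h.2.1, ?_, ?_⟩, ?_⟩, ?_⟩ <;> omega
    · intro π h; simp
    · rintro ⟨c, π⟩ h; simp
    · intro π h; simp

/-- The counting function. -/
def cnt (a n k s : ℕ) : ℕ := ((Pnk n k).filter (fun π => sreca π a = s)).card

lemma cnt_aux (a n k s e : ℕ) :
    (∑ π ∈ Pnk n k, if sreca π a + e = s then 1 else 0)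
      = if e ≤ s then cnt a n k (s - e) else 0 := by
  unfold cnt
  rw [Finset.card_filter]
  split_ifs with h
  · refine Finset.sum_congr rfl fun π _ => ?_
    congr 1
    rw [eq_iff_iff]
    omega
  · refine Finset.sum_eq_zero fun π _ => ?_
    rw [if_neg]
    omega

lemma cnt_succ (a n k s : ℕ) (ha : 1 ≤ a) :
    cnt a (n+1) (k+1) s =
      (if (if k+1 < a then k+1 else 0) ≤ s then
        cnt a n k (s - (if k+1 < a then k+1 else 0)) else 0) +
      ∑ c ∈ Finset.Icc 1 (k+1), (if (if k+1 < a then c else 0) ≤ s then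
        cnt a n (k+1) (s - (if k+1 < a then c else 0)) else 0) := by
  conv_lhs => unfold cnt
  rw [Finset.card_filter, sum_Pnk_succ]
  congr 1
  · rw [← cnt_aux]
    refine Finset.sum_congr rfl fun π h => ?_
    rw [mem_Pnk'] at h
    have : ((∀ j, π j ≠ a) ∧ k + 1 ≠ a) ↔ k + 1 < a := by
      rw [rg_mem_iff π a h.1 ha, h.2]
      omega
    rw [sreca_snoc, if_congr this rfl rfl]
  · refine Finset.sum_congr rfl fun c hc => ?_
    rw [← cnt_aux]
    refine Finset.sum_congr rfl fun π h => ?_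
    rw [mem_Pnk'] at h
    rw [Finset.mem_Icc] at hc
    have : ((∀ j, π j ≠ a) ∧ c ≠ a) ↔ k + 1 < a := by
      rw [rg_mem_iff π a h.1 ha, h.2]
      omega
    rw [sreca_snoc, if_congr this rfl rfl]

lemma cnt_zero_succ (a k s : ℕ) : cnt a 0 (k+1) s = 0 := by
  unfold cnt
  rw [Finset.card_eq_zero, Finset.filter_eq_empty_iff]
  intro π h
  rw [mem_Pnk'] at h
  simp at h

lemma cnt_succ_zero (a n s : ℕ) : cnt a (n+1) 0 s = 0 := by
  unfold cnt
  rw [Finset.card_eq_zero, Finset.filter_eq_empty_iff]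
  intro π h
  rw [mem_Pnk', ← Fin.snoc_init_self π, rg_snoc, rg_sup_snoc] at h
  omega

lemma cnt_zero_zero (a s : ℕ) : cnt a 0 0 s = if s = 0 then 1 else 0 := by
  unfold cnt
  have : Pnk 0 0 = Finset.univ := by
    ext π
    rw [mem_Pnk']
    simp [IsRGW, eq_iff_true_of_subsingleton]
  rw [this, Finset.card_filter]
  simp [sreca, eq_comm]

/-- The generating function, for every number of blocks. -/
noncomputable def gfF (a k : ℕ) : MvPowerSeries (Fin 2) ℚ :=
  fun d => (cnt a (d 0) k (d 1) : ℚ)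

lemma coeff_gfF (a k : ℕ) (d : Fin 2 →₀ ℕ) :
    MvPowerSeries.coeff d (gfF a k) = (cnt a (d 0) k (d 1) : ℚ) := rfl

lemma coeff_xq_mul (e : ℕ) (G : MvPowerSeries (Fin 2) ℚ) (d : Fin 2 →₀ ℕ) :
    MvPowerSeries.coeff d (MvPowerSeries.X 0 * MvPowerSeries.X 1 ^ e * G) =
      if 1 ≤ d 0 ∧ e ≤ d 1 then
        MvPowerSeries.coeff (d - (Finsupp.single 0 1 + Finsupp.single 1 e)) G else 0 := by
  have : (MvPowerSeries.X 0 * MvPowerSeries.X 1 ^ e : MvPowerSeries (Fin 2) ℚ) =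
      MvPowerSeries.monomial (Finsupp.single 0 1 + Finsupp.single 1 e) 1 := by
    rw [MvPowerSeries.X_pow_eq, MvPowerSeries.X, MvPowerSeries.monomial_mul_monomial, one_mul]
  rw [this, MvPowerSeries.coeff_monomial_mul, one_mul]
  congr 1
  rw [Finsupp.le_def, eq_iff_iff, Fin.forall_fin_two]
  simp

lemma gfF_zero (a : ℕ) : gfF a 0 = 1 := by
  classical
  ext d
  rw [coeff_gfF, MvPowerSeries.coeff_one]
  have hd : d = 0 ↔ d 0 = 0 ∧ d 1 = 0 := by
    rw [Finsupp.ext_iff, Fin.forall_fin_two]; simp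
  simp only [hd]
  rcases h : d 0 with _ | n
  · rw [cnt_zero_zero]; simp
  · rw [cnt_succ_zero]; simp

lemma gfF_succ (a k : ℕ) (ha : 1 ≤ a) :
    gfF a (k+1) =
      MvPowerSeries.X 0 * MvPowerSeries.X 1 ^ (if k+1 < a then k+1 else 0) * gfF a k +
      ∑ c ∈ Finset.Icc 1 (k+1),
        MvPowerSeries.X 0 * MvPowerSeries.X 1 ^ (if k+1 < a then c else 0) * gfF a (k+1) := by
  ext d
  rw [map_add, map_sum]
  simp only [coeff_xq_mul, coeff_gfF]
  rcases h : d 0 with _ | n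
  · simp [cnt_zero_succ]
  · rw [cnt_succ _ _ _ _ ha]
    push_cast
    simp [h]

lemma isUnit_aux (G : MvPowerSeries (Fin 2) ℚ) (h : MvPowerSeries.constantCoeff G = 0) :
    IsUnit (1 - G) := by
  rw [MvPowerSeries.isUnit_iff_constantCoeff]
  simp [h]

lemma solve_aux {R : Type*} [CommRing R] {D A B : R} (hD : IsUnit D) (h : D * A = B) :
    A = B * Ring.inverse D := by
  rw [← h, mul_right_comm, Ring.mul_inverse_cancel _ hD, one_mul]

lemma gfF_succ_lt (a k : ℕ) (ha : k + 1 < a) :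
    gfF a (k+1) = MvPowerSeries.X 0 * MvPowerSeries.X 1 ^ (k+1) * gfF a k *
      Ring.inverse (1 - MvPowerSeries.X 0 * MvPowerSeries.X 1 *
            ∑ t ∈ Finset.range (k+1), (MvPowerSeries.X 1 : MvPowerSeries (Fin 2) ℚ) ^ t) := by
  apply solve_aux
  · apply isUnit_aux; simp
  · have h := gfF_succ a k (by omega)
    simp only [if_pos ha] at h
    rw [← Finset.sum_mul, ← Finset.mul_sum] at h
    have h2 : ∑ c ∈ Finset.Icc 1 (k+1), (MvPowerSeries.X 1 : MvPowerSeries (Fin 2) ℚ) ^ c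
        = MvPowerSeries.X 1 * ∑ t ∈ Finset.range (k+1), MvPowerSeries.X 1 ^ t := by
      rw [Finset.mul_sum, Finset.range_eq_Ico, ← Finset.Ico_add_one_right_eq_Icc,
        ← Finset.sum_Ico_add' _ 0 (k+1) 1]
      exact Finset.sum_congr rfl fun i _ => pow_succ' _ _
    rw [h2] at h
    linear_combination h

lemma gfF_succ_ge (a k : ℕ) (h1 : 1 ≤ a) (ha : a ≤ k + 1) :
    gfF a (k+1) = MvPowerSeries.X 0 * gfF a k *
      Ring.inverse (1 - ((k+1 : ℕ) : MvPowerSeries (Fin 2) ℚ) * MvPowerSeries.X 0) := by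
  apply solve_aux
  · apply isUnit_aux; simp
  · have h := gfF_succ a k h1
    simp only [if_neg (not_lt.2 ha), pow_zero, mul_one, Finset.sum_const, Nat.card_Icc,
      nsmul_eq_mul, Nat.add_sub_cancel] at h
    linear_combination h

lemma gfF_lt (a k : ℕ) (ha : k < a) :
    gfF a k = MvPowerSeries.X 0 ^ k * MvPowerSeries.X 1 ^ ((k + 1) * k / 2) *
      ∏ j ∈ Finset.Icc 1 k,
          Ring.inverse (1 - MvPowerSeries.X 0 * MvPowerSeries.X 1 *
            ∑ t ∈ Finset.range j, (MvPowerSeries.X 1 : MvPowerSeries (Fin 2) ℚ) ^ t) := by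
  induction k with
  | zero => simp [gfF_zero]
  | succ k ih =>
    rw [gfF_succ_lt a k ha, ih (by omega), Finset.prod_Icc_succ_top (by omega)]
    have : (k + 1 + 1) * (k + 1) / 2 = (k + 1) * k / 2 + (k + 1) := by
      rw [← Nat.add_mul_div_left _ _ (by norm_num : 0 < 2)]
      congr 1; ring
    rw [this]
    ring

lemma gfF_ge (b k : ℕ) (hk : b ≤ k) :
    gfF (b+1) k = MvPowerSeries.X 0 ^ k * MvPowerSeries.X 1 ^ ((b + 1) * b / 2) *
      (∏ j ∈ Finset.Icc 1 b,
          Ring.inverse (1 - MvPowerSeries.X 0 * MvPowerSeries.X 1 *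
            ∑ t ∈ Finset.range j, (MvPowerSeries.X 1 : MvPowerSeries (Fin 2) ℚ) ^ t)) *
        ∏ i ∈ Finset.Icc (b+1) k,
          Ring.inverse (1 - (i : MvPowerSeries (Fin 2) ℚ) * MvPowerSeries.X 0) := by
  induction k, hk using Nat.le_induction with
  | base => rw [gfF_lt (b+1) b (by omega)]; simp
  | succ k hk ih =>
    rw [gfF_succ_ge (b+1) k (by omega) (by omega), ih, Finset.prod_Icc_succ_top (by omega)]
    ring

/-- For `1 ≤ a ≤ k`, the bivariate generating function
`P_{k,a}(x,q) = Σ_{n≥k} Σ_{π ∈ P_{n,k}} x^n q^{srec_a(π)}` (given here by its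
coefficients: the coefficient of `x^{d 0} q^{d 1}` counts the `π ∈ P_{d 0, k}` with
`srec_a(π) = d 1`) equals
`x^k q^{a(a-1)/2} ∏_{j=1}^{a-1} (1 - xq(1+q+⋯+q^{j-1}))⁻¹ ∏_{i=a}^{k} (1 - ix)⁻¹`
in `ℚ[[x,q]]`, the inverses being `Ring.inverse` of the corresponding units. -/
theorem sum_elements_record_a_gf (k a : ℕ) (ha : 1 ≤ a) (hak : a ≤ k)
    (F : MvPowerSeries (Fin 2) ℚ)
    (hF : ∀ d : Fin 2 →₀ ℕ,
      MvPowerSeries.coeff d F =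
        (((Pnk (d 0) k).filter (fun π => sreca π a = d 1)).card : ℚ)) :
    F = (MvPowerSeries.X 0 : MvPowerSeries (Fin 2) ℚ) ^ k *
          (MvPowerSeries.X 1) ^ (a * (a - 1) / 2) *
        (∏ j ∈ Finset.Icc 1 (a - 1),
          Ring.inverse (1 - MvPowerSeries.X 0 * MvPowerSeries.X 1 *
            ∑ t ∈ Finset.range j, (MvPowerSeries.X 1 : MvPowerSeries (Fin 2) ℚ) ^ t)) *
        ∏ i ∈ Finset.Icc a k,
          Ring.inverse (1 - (i : MvPowerSeries (Fin 2) ℚ) * MvPowerSeries.X 0) := by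
  obtain ⟨b, rfl⟩ : ∃ b, a = b + 1 := ⟨a - 1, by omega⟩
  have h : F = gfF (b+1) k := by
    ext d
    rw [hF, coeff_gfF, cnt]
  rw [h, gfF_ge b k (by omega)]
  simp only [Nat.add_sub_cancel]
end

section
/- Let k ≥ 1 and let y be a real number with y ∉ {1, 2, …, k}. Then ( Σ_{a=1}^{k} a(a−1)/2 + Σ_{i=1}^{k} ((k−i)·i·(i+1))/(2(y−i)) ) · ∏_{i=1}^{k} 1/(y−i) = Σ_{m=1}^{k} ( a_{k,m}/(y−m)² + b_{k,m}/(y−m) ), where a_{k,m} = (−1)^{k−m} (k−m) m (m+1) / (2 (m−1)! (k−m)!) and b_{k,m} = (−1)^{k−m} ( −k³/12 − k²(m+1)/4 + k(6m² + 21m + 10)/12 − 3m²/2 − m + Σ_{i=1}^{k} i(i−1)/2 ) / ((m−1)! (k−m)!). -/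
open Finset PowerSeries

/-- The partial fraction weights of the product of the `1/(y-i)`. -/
noncomputable def pfW (k m : ℕ) : ℝ :=
  (-1 : ℝ) ^ (k - m) / ((m - 1).factorial * (k - m).factorial)

lemma pfW_succ (k m : ℕ) (hm : m ≤ k) : pfW (k+1) m = pfW k m / ((m:ℝ) - (k+1)) := by
  obtain ⟨j, rfl⟩ := Nat.exists_eq_add_of_le hm
  have h1 : m + j + 1 - m = j + 1 := by omega
  have h2 : m + j - m = j := by omega
  have h3 : ((m:ℝ) - ((m + j : ℕ) + 1)) = -((j:ℝ)+1) := by push_cast; ring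
  have h4 : (j:ℝ) + 1 ≠ 0 := by positivity
  unfold pfW
  rw [h1, h2, h3, Nat.factorial_succ, pow_succ]
  push_cast
  field_simp

lemma pf_ne {k m : ℕ} (hm : m ∈ Finset.Icc 1 k) : ((m:ℝ) - (k+1)) ≠ 0 := by
  have h : (m:ℝ) ≤ k := by exact_mod_cast (Finset.mem_Icc.mp hm).2
  intro h'; linarith

lemma pfW_self (k : ℕ) : pfW (k+1) (k+1) = 1 / (k.factorial : ℝ) := by
  simp [pfW]

lemma pf_prod_aux (k j : ℕ) (h : j ≤ k) :
    ∏ i ∈ Finset.Icc 1 j, 1 / (((k:ℝ)+1) - (i : ℝ)) = ((k-j).factorial : ℝ) / (k.factorial : ℝ) := by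
  induction j with
  | zero => simp [Nat.factorial_ne_zero]
  | succ j ih =>
    rw [Finset.prod_Icc_succ_top (by omega), ih (by omega)]
    obtain ⟨l, rfl⟩ := Nat.exists_eq_add_of_le h
    have h1 : j + 1 + l - j = l + 1 := by omega
    have h2 : j + 1 + l - (j + 1) = l := by omega
    have h3 : ((j + 1 + l : ℕ) : ℝ) + 1 - ((j + 1 : ℕ) : ℝ) = l + 1 := by push_cast; ring
    have h4 : (l:ℝ) + 1 ≠ 0 := by positivity
    rw [h1, h2, h3, Nat.factorial_succ l]
    push_cast
    field_simp

lemma pf_prod (k : ℕ) :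
    ∏ i ∈ Finset.Icc 1 k, 1 / (((k:ℝ)+1) - (i : ℝ)) = 1 / (k.factorial : ℝ) := by
  rw [pf_prod_aux k k le_rfl]; simp

lemma pf_A (k : ℕ) (hk : 1 ≤ k) : ∀ y : ℝ, (∀ i ∈ Finset.Icc 1 k, y ≠ (i : ℝ)) →
    ∑ m ∈ Finset.Icc 1 k, pfW k m / (y - m) = ∏ i ∈ Finset.Icc 1 k, 1 / (y - (i : ℝ)) := by
  induction k, hk using Nat.le_induction with
  | base => intro y hy; simp [pfW]
  | succ k hk ih =>
    intro y hy
    have hy' : ∀ i ∈ Finset.Icc 1 k, y ≠ (i : ℝ) := fun i hi =>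
      hy i (Finset.mem_Icc.mpr ⟨(Finset.mem_Icc.mp hi).1, by have := (Finset.mem_Icc.mp hi).2; omega⟩)
    have hK : y - ((k:ℝ)+1) ≠ 0 := by
      have := hy (k+1) (by simp)
      push_cast at this
      exact sub_ne_zero.mpr this
    have e := ih ((k:ℝ)+1) (fun i hi => by
      have := pf_ne hi
      intro h; apply this; rw [h]; ring)
    rw [pf_prod, ← pfW_self] at e
    rw [Finset.sum_Icc_succ_top (by omega), Finset.prod_Icc_succ_top (by omega), ← ih y hy', ← e,
      Finset.sum_div, Finset.sum_mul, ← Finset.sum_add_distrib]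
    refine Finset.sum_congr rfl fun m hm => ?_
    have h1 := pf_ne hm
    have h2 : y - m ≠ 0 := sub_ne_zero.mpr (hy' m hm)
    have h3 : (k:ℝ) + 1 - m ≠ 0 := by intro h; apply h1; linarith
    rw [pfW_succ k m (Finset.mem_Icc.mp hm).2]
    have h4 : (m:ℝ) - (k+1) = -((k:ℝ) + 1 - m) := by ring
    rw [h4]
    push_cast
    field_simp
    ring

lemma pf_M0 (k : ℕ) (hk : 1 ≤ k) : ∑ m ∈ Finset.Icc 1 (k+1), pfW (k+1) m = 0 := by
  have e := pf_A k hk ((k:ℝ)+1) (fun i hi => by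
      have := pf_ne hi
      intro h; apply this; rw [h]; ring)
  rw [pf_prod, ← pfW_self] at e
  rw [Finset.sum_Icc_succ_top (by omega), ← e, ← Finset.sum_add_distrib]
  refine Finset.sum_eq_zero fun m hm => ?_
  have h1 := pf_ne hm
  rw [pfW_succ k m (Finset.mem_Icc.mp hm).2]
  have h4 : (m:ℝ) - (k+1) = -((k:ℝ) + 1 - m) := by ring
  rw [h4, div_neg]; ring

lemma pf_M1 (k : ℕ) (hk : 1 ≤ k) : ∑ m ∈ Finset.Icc 1 (k+2), pfW (k+2) m * m = 0 := by
  have h0 := pf_M0 (k+1) (by omega)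
  have h1 := pf_M0 k hk
  have h2 : ∑ m ∈ Finset.Icc 1 (k+1+1), pfW (k+1+1) m * ((m:ℝ) - ((k+1:ℕ)+1)) = 0 := by
    rw [Finset.sum_Icc_succ_top (by omega), ← h1]
    push_cast
    simp only [sub_self, mul_zero, add_zero]
    refine Finset.sum_congr rfl fun m hm => ?_
    have := pf_ne hm
    push_cast at this
    rw [pfW_succ (k+1) m (Finset.mem_Icc.mp hm).2]
    push_cast
    field_simp
  simp only [mul_sub] at h2
  rw [Finset.sum_sub_distrib, ← Finset.sum_mul, h0] at h2
  simpa using h2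

lemma pf_B (k : ℕ) (hk : 1 ≤ k) : ∀ y : ℝ, (∀ i ∈ Finset.Icc 1 k, y ≠ (i : ℝ)) →
    ∑ m ∈ Finset.Icc 1 k, pfW k m / (y - m) ^ 2 =
      (∑ i ∈ Finset.Icc 1 k, 1 / (y - (i:ℝ))) * ∏ i ∈ Finset.Icc 1 k, 1 / (y - (i : ℝ)) := by
  induction k, hk using Nat.le_induction with
  | base => intro y hy; simp [pfW, sq]
  | succ k hk ih =>
    intro y hy
    have hA := pf_A (k+1) (by omega) y hy
    have hy' : ∀ i ∈ Finset.Icc 1 k, y ≠ (i : ℝ) := fun i hi =>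
      hy i (Finset.mem_Icc.mpr ⟨(Finset.mem_Icc.mp hi).1, by have := (Finset.mem_Icc.mp hi).2; omega⟩)
    have hK : y - ((k:ℝ)+1) ≠ 0 := by
      have := hy (k+1) (by simp)
      push_cast at this
      exact sub_ne_zero.mpr this
    have hB := ih y hy'
    have key : ∑ m ∈ Finset.Icc 1 k, pfW (k+1) m / (y - m) ^ 2 =
        (∑ m ∈ Finset.Icc 1 k, pfW (k+1) m / (y - m) + ∑ m ∈ Finset.Icc 1 k, pfW k m / (y - m) ^ 2)
          / (y - ((k:ℝ)+1)) := by
      rw [← Finset.sum_add_distrib, Finset.sum_div]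
      refine Finset.sum_congr rfl fun m hm => ?_
      have h1 := pf_ne hm
      have h2 : y - m ≠ 0 := sub_ne_zero.mpr (hy' m hm)
      rw [pfW_succ k m (Finset.mem_Icc.mp hm).2]
      field_simp
      ring
    rw [Finset.sum_Icc_succ_top (by omega)] at hA
    rw [Finset.sum_Icc_succ_top (by omega), key, hB, eq_sub_of_add_eq hA,
      Finset.sum_Icc_succ_top (by omega), Finset.prod_Icc_succ_top (by omega)]
    push_cast
    field_simp
    ring

lemma pf_S1 (k : ℕ) : ∑ i ∈ Finset.Icc 1 k, (i:ℝ) = k * (k+1) / 2 := by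
  induction k with
  | zero => simp
  | succ k ih => rw [Finset.sum_Icc_succ_top (by omega), ih]; push_cast; ring

lemma pf_S2 (k : ℕ) : ∑ i ∈ Finset.Icc 1 k, (i:ℝ)^2 = k * (k+1) * (2*k+1) / 6 := by
  induction k with
  | zero => simp
  | succ k ih => rw [Finset.sum_Icc_succ_top (by omega), ih]; push_cast; ring

/-- The correction terms cancel. -/
lemma pf_E (k : ℕ) (hk : 1 ≤ k) (y : ℝ) :
    ∑ m ∈ Finset.Icc 1 k, pfW k m * ((k:ℝ)/2 - (y+2*m+1)/2 - (k:ℝ)^2/2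
      + (k*(y+m)+k*(k+1)/2+k)/2) = 0 := by
  have split : ∑ m ∈ Finset.Icc 1 k, pfW k m * ((k:ℝ)/2 - (y+2*m+1)/2 - (k:ℝ)^2/2
      + (k*(y+m)+k*(k+1)/2+k)/2) =
      (∑ m ∈ Finset.Icc 1 k, pfW k m) * ((k:ℝ)/2 - (y+1)/2 - (k:ℝ)^2/2
      + (k*y+k*(k+1)/2+k)/2) + (∑ m ∈ Finset.Icc 1 k, pfW k m * m) * ((k:ℝ)/2 - 1) := by
    rw [Finset.sum_mul, Finset.sum_mul, ← Finset.sum_add_distrib]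
    refine Finset.sum_congr rfl fun m hm => ?_
    ring
  rw [split]
  match k, hk with
  | 1, _ => simp [pfW]; ring
  | 2, _ => rw [pf_M0 1 le_rfl]; simp
  | k+3, _ => rw [pf_M0 (k+2) (by omega), pf_M1 (k+1) (by omega)]; simp

lemma pf_D (k : ℕ) (y : ℝ) (hy : ∀ i ∈ Finset.Icc 1 k, y ≠ (i : ℝ)) :
    ∑ i ∈ Finset.Icc 1 k,
          ((k : ℝ) - (i : ℝ)) * (i : ℝ) * ((i : ℝ) + 1) / (2 * (y - (i : ℝ))) =
    (k - y) * y * (y + 1) / 2 * (∑ i ∈ Finset.Icc 1 k, 1 / (y - (i:ℝ)))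
      - ((k:ℝ)/2*(k*y+k*(k+1)/2+k)
        - (k*y^2+y*(k*(k+1)/2)+k*(k+1)*(2*k+1)/6+k*y+k*(k+1)/2)/2) := by
  have h : ∀ i ∈ Finset.Icc 1 k,
      ((k : ℝ) - (i : ℝ)) * (i : ℝ) * ((i : ℝ) + 1) / (2 * (y - (i : ℝ))) =
      (k - y) * y * (y + 1) / 2 * (1 / (y - (i:ℝ))) - (((k:ℝ)/2*(y+1) - (y^2+y)/2)
        + ((k:ℝ)/2 - (y+1)/2) * i - 1/2 * (i:ℝ)^2) := by
    intro i hi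
    have h2 : y - i ≠ 0 := sub_ne_zero.mpr (hy i hi)
    field_simp
    ring
  rw [Finset.sum_congr rfl h, Finset.sum_sub_distrib, Finset.sum_sub_distrib,
    Finset.sum_add_distrib, ← Finset.mul_sum, ← Finset.mul_sum, ← Finset.mul_sum, pf_S1, pf_S2]
  simp
  ring

/-- Partial fraction decomposition: for `k ≥ 1` and real
`y ∉ {1, …, k}`,
`(Σ_{a=1}^{k} a(a-1)/2 + Σ_{i=1}^{k} ((k-i)i(i+1))/(2(y-i))) ∏_{i=1}^{k} 1/(y-i)
   = Σ_{m=1}^{k} ( a_{k,m}/(y-m)² + b_{k,m}/(y-m) )`,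
with `a_{k,m} = (-1)^{k-m}(k-m)m(m+1)/(2(m-1)!(k-m)!)` and
`b_{k,m} = (-1)^{k-m}(-k³/12 - k²(m+1)/4 + k(6m²+21m+10)/12 - 3m²/2 - m
  + Σ_{i=1}^{k} i(i-1)/2)/((m-1)!(k-m)!)`. -/
theorem partial_fraction_decomposition (k : ℕ) (hk : 1 ≤ k) (y : ℝ)
    (hy : ∀ i ∈ Finset.Icc 1 k, y ≠ (i : ℝ)) :
    ((∑ a ∈ Finset.Icc 1 k, (a : ℝ) * ((a : ℝ) - 1) / 2) +
        ∑ i ∈ Finset.Icc 1 k,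
          ((k : ℝ) - (i : ℝ)) * (i : ℝ) * ((i : ℝ) + 1) / (2 * (y - (i : ℝ)))) *
      ∏ i ∈ Finset.Icc 1 k, 1 / (y - (i : ℝ)) =
    ∑ m ∈ Finset.Icc 1 k,
      ((-1 : ℝ) ^ (k - m) * ((k : ℝ) - (m : ℝ)) * (m : ℝ) * ((m : ℝ) + 1) /
          (2 * (m - 1).factorial * (k - m).factorial) / (y - (m : ℝ)) ^ 2 +
        (-1 : ℝ) ^ (k - m) *
          (-(k : ℝ) ^ 3 / 12 - (k : ℝ) ^ 2 * ((m : ℝ) + 1) / 4 +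
            (k : ℝ) * (6 * (m : ℝ) ^ 2 + 21 * (m : ℝ) + 10) / 12 -
            3 * (m : ℝ) ^ 2 / 2 - (m : ℝ) +
            ∑ i ∈ Finset.Icc 1 k, (i : ℝ) * ((i : ℝ) - 1) / 2) /
          ((m - 1).factorial * (k - m).factorial) / (y - (m : ℝ))) := by
  generalize (∑ a ∈ Finset.Icc 1 k, (a : ℝ) * ((a : ℝ) - 1) / 2) = C
  have hA := pf_A k hk y hy
  have hB := pf_B k hk y hy
  have hE := pf_E k hk y
  rw [pf_D k y hy]
  set D : ℝ := ((k:ℝ)/2*(k*y+k*(k+1)/2+k)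
        - (k*y^2+y*(k*(k+1)/2)+k*(k+1)*(2*k+1)/6+k*y+k*(k+1)/2)/2) with hD
  have expand : ∀ S P : ℝ, (C + ((k - y) * y * (y + 1) / 2 * S - D)) * P =
      (C - D) * P + (k - y) * y * (y + 1) / 2 * (S * P) := by intros; ring
  rw [expand, ← hB, ← hA, Finset.mul_sum, Finset.mul_sum, ← Finset.sum_add_distrib]
  refine (sub_zero _).symm.trans ?_
  rw [← hE, ← Finset.sum_sub_distrib]
  refine Finset.sum_congr rfl fun m hm => ?_
  have h2 : y - m ≠ 0 := sub_ne_zero.mpr (hy m hm)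
  unfold pfW
  rw [hD]
  have f1 : ((m-1).factorial : ℝ) ≠ 0 := by positivity
  have f2 : ((k-m).factorial : ℝ) ≠ 0 := by positivity
  field_simp
  ring
end

section
/- In the ring of formal power series ℚ[[x]], the exponential generating function of the total srec statistic over all set partitions satisfies Σ_{n≥0} (Σ_{π ∈ P_n} srec(π)) x^n/n! = exp(exp(x) − 1) · ( (1/3)·exp(3x) − (1/2)·x·exp(2x) + (3/4)·exp(2x) − x·exp(x) − exp(x) − 1/12 ), where exp(cx) denotes the formal power series Σ_{n≥0} c^n x^n/n!. -/
open Finset PowerSeries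

theorem mem_Pall {n : ℕ} (π : Fin n → ℕ) : π ∈ Pall n ↔ IsRGW π := by
  unfold Pall
  simp only [Finset.mem_image, Finset.mem_filter, Finset.mem_univ, true_and]
  constructor
  · rintro ⟨p, hp, rfl⟩
    exact hp
  · intro h
    have hb : ∀ m : ℕ, ∀ i : Fin n, (i : ℕ) = m → π i ≤ m + 1 := by
      intro m
      induction m using Nat.strong_induction_on with
      | _ m ih =>
        intro i hi
        refine (h i).2.trans ?_
        have : (Finset.univ.filter (fun j => j < i)).sup π ≤ m := by
          apply Finset.sup_le
          intro j hj
          simp only [Finset.mem_filter, Finset.mem_univ, true_and] at hj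
          have hj' : (j : ℕ) < m := by rw [← hi]; exact hj
          have := ih j hj' j rfl
          omega
        omega
    refine ⟨fun i => ⟨π i, ?_⟩, ?_, ?_⟩
    · have := hb i i rfl
      have := i.2
      omega
    · exact h
    · rfl

theorem sup_snoc_last {n : ℕ} (π : Fin n → ℕ) (x : ℕ) :
    (Finset.univ.filter (fun j => j < Fin.last n)).sup (Fin.snoc π x : Fin (n+1) → ℕ)
      = Finset.univ.sup π := by
  apply eq_of_forall_ge_iff
  intro c
  simp [Finset.sup_le_iff, Fin.forall_fin_succ', Fin.castSucc_lt_last]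

theorem sup_snoc_castSucc {n : ℕ} (π : Fin n → ℕ) (x : ℕ) (i : Fin n) :
    (Finset.univ.filter (fun j => j < i.castSucc)).sup (Fin.snoc π x : Fin (n+1) → ℕ)
      = (Finset.univ.filter (fun j => j < i)).sup π := by
  apply eq_of_forall_ge_iff
  intro c
  have : ¬ (Fin.last n < i.castSucc) := not_lt.2 (Fin.le_last _)
  simp [Finset.sup_le_iff, Fin.forall_fin_succ', this]

theorem sup_snoc {n : ℕ} (π : Fin n → ℕ) (x : ℕ) :
    Finset.univ.sup (Fin.snoc π x : Fin (n+1) → ℕ) = max (Finset.univ.sup π) x := by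
  apply eq_of_forall_ge_iff
  intro c
  simp [Finset.sup_le_iff, Fin.forall_fin_succ']

theorem isRGW_snoc {n : ℕ} (π : Fin n → ℕ) (x : ℕ) :
    IsRGW (Fin.snoc π x : Fin (n+1) → ℕ) ↔
      IsRGW π ∧ 1 ≤ x ∧ x ≤ Finset.univ.sup π + 1 := by
  unfold IsRGW
  rw [Fin.forall_fin_succ']
  simp only [sup_snoc_last, sup_snoc_castSucc, Fin.snoc_castSucc, Fin.snoc_last]

theorem sum_Pall_succ {n : ℕ} (f : (Fin (n+1) → ℕ) → ℚ) :
    ∑ π ∈ Pall (n+1), f π =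
      ∑ π ∈ Pall n, ∑ x ∈ Finset.Icc 1 (Finset.univ.sup π + 1), f (Fin.snoc π x) := by
  rw [Finset.sum_sigma']
  refine Finset.sum_bij' (fun π _ => ⟨Fin.init π, π (Fin.last n)⟩)
    (fun p _ => Fin.snoc p.1 p.2) ?_ ?_ ?_ ?_ ?_
  · intro π hπ
    rw [mem_Pall, ← Fin.snoc_init_self π, isRGW_snoc] at hπ
    simp only [Finset.mem_sigma, mem_Pall, Finset.mem_Icc]
    exact hπ
  · rintro ⟨π, x⟩ h
    simp only [Finset.mem_sigma, mem_Pall, Finset.mem_Icc] at h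
    rw [mem_Pall, isRGW_snoc]
    exact h
  · intro π _
    exact Fin.snoc_init_self π
  · rintro ⟨π, x⟩ _
    simp
  · intro π _
    simp only [Fin.snoc_init_self]

theorem exists_eq_of_le_sup {n : ℕ} {π : Fin n → ℕ} (h : IsRGW π) {a : ℕ} (ha : 1 ≤ a)
    (ha' : a ≤ Finset.univ.sup π) : ∃ i, π i = a := by
  have hne : {i | a ≤ π i}.Nonempty := by
    by_contra hcon
    have : Finset.univ.sup π < a := by
      rw [Finset.sup_lt_iff (Nat.lt_of_lt_of_le Nat.zero_lt_one ha)]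
      intro i _
      by_contra hi
      exact hcon ⟨i, not_lt.1 hi⟩
    omega
  obtain ⟨i, hi, hmin⟩ := WellFounded.has_min (wellFounded_lt (α := Fin n)) _ hne
  refine ⟨i, le_antisymm ?_ hi⟩
  refine (h i).2.trans ?_
  have : (Finset.univ.filter (fun j => j < i)).sup π < a := by
    rw [Finset.sup_lt_iff (Nat.lt_of_lt_of_le Nat.zero_lt_one ha)]
    intro j hj
    simp only [Finset.mem_filter, Finset.mem_univ, true_and] at hj
    by_contra hc
    exact hmin j (not_lt.1 hc) hj
  omega

theorem sreca_snoc_s5 {n : ℕ} (π : Fin n → ℕ) (x a : ℕ) (h : x = a ∨ ∃ i, π i = a) :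
    sreca (Fin.snoc π x : Fin (n+1) → ℕ) a = sreca π a := by
  unfold sreca
  rw [Finset.sum_filter, Finset.sum_filter, Fin.sum_univ_castSucc]
  have h1 : ¬ (∀ j, j ≤ Fin.last n → (Fin.snoc π x : Fin (n+1) → ℕ) j ≠ a) := by
    intro hc
    rcases h with h | ⟨i, hi⟩
    · exact hc (Fin.last n) le_rfl (by simpa using h)
    · exact hc i.castSucc (Fin.le_last _) (by simpa using hi)
  rw [if_neg h1, add_zero]
  apply Finset.sum_congr rfl
  intro i _
  have h2 : ¬ (Fin.last n ≤ i.castSucc) := not_le.2 (Fin.castSucc_lt_last i)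
  have h3 : (∀ j, j ≤ i.castSucc → (Fin.snoc π x : Fin (n+1) → ℕ) j ≠ a) ↔
      ∀ j, j ≤ i → π j ≠ a := by
    rw [Fin.forall_fin_succ']
    simp [h2]
  simp only [h3, Fin.snoc_castSucc]

theorem sreca_new {n : ℕ} (π : Fin n → ℕ) : sreca π (Finset.univ.sup π + 1) = ∑ i, π i := by
  unfold sreca
  rw [Finset.filter_true_of_mem]
  intro i _ j _
  have : π j ≤ Finset.univ.sup π := Finset.le_sup (Finset.mem_univ j)
  omega

theorem srec_snoc_le {n : ℕ} {π : Fin n → ℕ} (h : IsRGW π) {x : ℕ}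
    (hx : x ≤ Finset.univ.sup π) : srec (Fin.snoc π x : Fin (n+1) → ℕ) = srec π := by
  unfold srec
  rw [sup_snoc, max_eq_left hx]
  apply Finset.sum_congr rfl
  intro a ha
  rw [Finset.mem_Icc] at ha
  exact sreca_snoc_s5 π x a (Or.inr (exists_eq_of_le_sup h ha.1 ha.2))

theorem srec_snoc_new {n : ℕ} {π : Fin n → ℕ} (h : IsRGW π) :
    srec (Fin.snoc π (Finset.univ.sup π + 1) : Fin (n+1) → ℕ) = srec π + ∑ i, π i := by
  unfold srec
  rw [sup_snoc, max_eq_right (Nat.le_succ _), Finset.sum_Icc_succ_top (by omega),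
    sreca_snoc_s5 _ _ _ (Or.inl rfl), sreca_new]
  congr 1
  apply Finset.sum_congr rfl
  intro a ha
  rw [Finset.mem_Icc] at ha
  exact sreca_snoc_s5 π _ a (Or.inr (exists_eq_of_le_sup h ha.1 ha.2))

/-- Number of completions by `m` letters from a word with maximum `k`. -/
def cA : ℕ → ℕ → ℚ
  | 0, _ => 1
  | m + 1, k => k * cA m k + cA m (k + 1)

/-- Total number of new records over completions. -/
def cB : ℕ → ℕ → ℚ
  | 0, _ => 0
  | m + 1, k => k * cB m k + cB m (k + 1) + cA m (k + 1)

/-- Total contribution of the new letters. -/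
def cC : ℕ → ℕ → ℚ
  | 0, _ => 0
  | m + 1, k => k * cC m k + cC m (k + 1) + (k * (k + 1) / 2) * cB m k
      + (k + 1) * cB m (k + 1)

theorem sum_Icc_cast (k : ℕ) : ∑ x ∈ Finset.Icc 1 k, (x : ℚ) = k * (k + 1) / 2 := by
  induction k with
  | zero => simp
  | succ k ih =>
    rw [Finset.sum_Icc_succ_top (by omega), ih]
    push_cast
    ring

theorem total_eq (m : ℕ) : ∀ n N : ℕ, N = n + m →
    ∑ π ∈ Pall N, (srec π : ℚ) = ∑ π ∈ Pall n,
      ((srec π : ℚ) * cA m (Finset.univ.sup π) + ((∑ i, π i : ℕ) : ℚ) * cB m (Finset.univ.sup π)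
        + cC m (Finset.univ.sup π)) := by
  induction m with
  | zero =>
    rintro n N rfl
    simp [cA, cB, cC]
  | succ m ih =>
    intro n N hN
    rw [ih (n+1) N (by omega), sum_Pall_succ]
    apply Finset.sum_congr rfl
    intro π hπ
    rw [mem_Pall] at hπ
    rw [Finset.sum_Icc_succ_top (by omega)]
    have h1 : ∀ x ∈ Finset.Icc 1 (Finset.univ.sup π),
        ((srec (Fin.snoc π x : Fin (n+1) → ℕ) : ℚ)
          * cA m (Finset.univ.sup (Fin.snoc π x : Fin (n+1) → ℕ))
          + ((∑ i, (Fin.snoc π x : Fin (n+1) → ℕ) i : ℕ) : ℚ)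
          * cB m (Finset.univ.sup (Fin.snoc π x : Fin (n+1) → ℕ))
          + cC m (Finset.univ.sup (Fin.snoc π x : Fin (n+1) → ℕ)))
        = ((srec π : ℚ) * cA m (Finset.univ.sup π)
          + ((∑ i, π i : ℕ) : ℚ) * cB m (Finset.univ.sup π)
          + cC m (Finset.univ.sup π)) + (x : ℚ) * cB m (Finset.univ.sup π) := by
      intro x hx
      rw [Finset.mem_Icc] at hx
      rw [srec_snoc_le hπ hx.2, sup_snoc, max_eq_left hx.2, Fin.sum_univ_castSucc]
      simp only [Fin.snoc_castSucc, Fin.snoc_last, Nat.cast_add]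
      ring
    rw [Finset.sum_congr rfl h1, Finset.sum_add_distrib, ← Finset.sum_mul, sum_Icc_cast,
      srec_snoc_new hπ, sup_snoc, max_eq_right (Nat.le_succ _), Fin.sum_univ_castSucc]
    simp only [Fin.snoc_castSucc, Fin.snoc_last, Nat.cast_add, Finset.sum_const, Nat.card_Icc,
      cA, cB, cC, nsmul_eq_mul, Nat.add_sub_cancel, Nat.cast_one]
    ring

theorem total_eq_cC (n : ℕ) : ∑ π ∈ Pall n, (srec π : ℚ) = cC n 0 := by
  rw [total_eq n 0 n (by omega)]
  have : Pall 0 = {Fin.elim0} := by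
    ext π
    rw [mem_Pall, Finset.mem_singleton]
    constructor
    · intro _
      exact Subsingleton.elim _ _
    · intro _ i
      exact i.elim0
  rw [this, Finset.sum_singleton]
  simp [srec]

/-! Power series part -/

theorem coeff_pow_zero {f : PowerSeries ℚ} (hf : constantCoeff f = 0) {j m : ℕ} (h : j < m) :
    coeff j (f ^ m) = 0 := by
  have : (X : PowerSeries ℚ) ^ m ∣ f ^ m := pow_dvd_pow_of_dvd (X_dvd_iff.2 hf) m
  exact X_pow_dvd_iff.1 this j h

theorem derivative_psExp {f : PowerSeries ℚ} (hf : constantCoeff f = 0) :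
    derivative ℚ (psExp f) = derivative ℚ f * psExp f := by
  ext n
  rw [coeff_derivative, coeff_mul]
  have h1 : ∀ p ∈ Finset.HasAntidiagonal.antidiagonal n, coeff p.1 (derivative ℚ f) * coeff p.2 (psExp f)
      = ∑ m ∈ Finset.range (n+1), coeff p.1 (derivative ℚ f) * coeff p.2 (f ^ m) / m.factorial := by
    intro p hp
    rw [Finset.HasAntidiagonal.mem_antidiagonal] at hp
    rw [psExp, coeff_mk, Finset.mul_sum]
    refine (Finset.sum_subset_zero_on_sdiff ?_ ?_ ?_)
    · intro m hm
      rw [Finset.mem_range] at *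
      omega
    · intro m hm
      simp only [Finset.mem_sdiff, Finset.mem_range] at hm
      rw [coeff_pow_zero hf (by omega)]
      simp
    · intro m _
      ring
  rw [Finset.sum_congr rfl h1, Finset.sum_comm, psExp, coeff_mk, Finset.sum_mul,
    Finset.sum_range_succ']
  have h0 : coeff (n+1) (f ^ 0) / (Nat.factorial 0 : ℚ) * ((n : ℚ) + 1) = 0 := by
    simp [coeff_one]
  rw [h0, add_zero]
  apply Finset.sum_congr rfl
  intro m _
  rw [← Finset.sum_div, ← coeff_mul]
  have h2 : coeff (n+1) (f ^ (m+1)) * ((n : ℚ) + 1) = (m + 1) * coeff n (derivative ℚ f * f ^ m) := by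
    rw [← coeff_derivative, Derivation.leibniz_pow]
    simp only [Nat.add_sub_cancel, smul_eq_mul, nsmul_eq_mul, ← map_natCast (C (R := ℚ)),
      coeff_C_mul, mul_comm (f ^ m)]
    push_cast
    ring
  have h3 : (m.factorial : ℚ) ≠ 0 := by positivity
  have h4 : ((m : ℚ) + 1) ≠ 0 := by positivity
  rw [div_mul_eq_mul_div, h2, Nat.factorial_succ]
  push_cast
  field_simp

theorem derivative_expc (c : ℚ) : derivative ℚ (expc c) = C c * expc c := by
  ext n
  rw [coeff_derivative, coeff_C_mul, expc, coeff_mk, coeff_mk, Nat.factorial_succ]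
  have h3 : (n.factorial : ℚ) ≠ 0 := by positivity
  have h4 : ((n : ℚ) + 1) ≠ 0 := by positivity
  push_cast
  field_simp
  ring

theorem constantCoeff_expc (c : ℚ) : constantCoeff (expc c) = 1 := by
  rw [← coeff_zero_eq_constantCoeff_apply, expc, coeff_mk]
  simp

theorem expc_ext {f g : PowerSeries ℚ} (h : derivative ℚ f = derivative ℚ g)
    (h0 : constantCoeff f = constantCoeff g) : f = g :=
  derivative.ext h h0

theorem eq_zero_of_ode {f : PowerSeries ℚ} {c : ℚ} (h : derivative ℚ f = C c * f)
    (h0 : constantCoeff f = 0) : f = 0 := by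
  ext n
  induction n with
  | zero => simpa using h0
  | succ n ih =>
    have := congrArg (coeff n) h
    rw [coeff_derivative, coeff_C_mul, ih] at this
    have h4 : ((n : ℚ) + 1) ≠ 0 := by positivity
    simpa [h4] using this

theorem expc_add (a b : ℚ) : expc (a + b) = expc a * expc b := by
  rw [← sub_eq_zero]
  apply eq_zero_of_ode (c := a + b)
  · simp only [map_sub, Derivation.leibniz, derivative_expc, smul_eq_mul, map_add]
    ring
  · simp [constantCoeff_expc]

/-- Coefficient times factorial. -/
noncomputable def ec (f : PowerSeries ℚ) (m : ℕ) : ℚ := m.factorial * coeff m f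

theorem ec_derivative (f : PowerSeries ℚ) (m : ℕ) : ec (derivative ℚ f) m = ec f (m+1) := by
  unfold ec
  rw [coeff_derivative, Nat.factorial_succ]
  push_cast
  ring

theorem ec_add (f g : PowerSeries ℚ) (m : ℕ) : ec (f + g) m = ec f m + ec g m := by
  unfold ec
  rw [map_add]
  ring

theorem ec_C_mul (c : ℚ) (f : PowerSeries ℚ) (m : ℕ) : ec (C c * f) m = c * ec f m := by
  unfold ec
  rw [coeff_C_mul]
  ring

theorem ec_zero (f : PowerSeries ℚ) : ec f 0 = constantCoeff f := by
  simp [ec]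

/-- The series `exp(exp(x)-1)`. -/
noncomputable def EE : PowerSeries ℚ := psExp (expc 1 - 1)

theorem derivative_EE : derivative ℚ EE = expc 1 * EE := by
  unfold EE
  rw [derivative_psExp (by simp [constantCoeff_expc])]
  simp [derivative_expc]

theorem constantCoeff_EE : constantCoeff EE = 1 := by
  rw [← coeff_zero_eq_constantCoeff_apply, EE, psExp, coeff_mk]
  simp

noncomputable def sA (k : ℕ) : PowerSeries ℚ := expc 1 ^ k * EE
noncomputable def sB (k : ℕ) : PowerSeries ℚ := expc 1 ^ k * EE * (expc 1 - 1)
noncomputable def al : PowerSeries ℚ := C (1/2) * (expc 1 - X - 1)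
noncomputable def be : PowerSeries ℚ :=
  expc 1 ^ 2 - X * expc 1 - C (1/2) * expc 1 - C (1/2) * X - C (1/2)
noncomputable def ga : PowerSeries ℚ :=
  C (1/3) * expc 1 ^ 3 - C (1/2) * (X * expc 1 ^ 2) + C (3/4) * expc 1 ^ 2
    - X * expc 1 - expc 1 - C (1/12)
noncomputable def sC (k : ℕ) : PowerSeries ℚ :=
  expc 1 ^ k * EE * (C (k : ℚ) ^ 2 * al + C (k : ℚ) * be + ga)

theorem d_e : derivative ℚ (expc 1) = expc 1 := by
  rw [derivative_expc]; simp

theorem d_C (c : ℚ) : derivative ℚ (C c) = 0 := derivative_C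

theorem d_pow (k : ℕ) : derivative ℚ (expc 1 ^ k) = C (k : ℚ) * expc 1 ^ k := by
  induction k with
  | zero => simp
  | succ k ih =>
    rw [pow_succ, Derivation.leibniz, ih, d_e]
    simp only [smul_eq_mul, Nat.cast_add, Nat.cast_one, map_add, map_one]
    ring

theorem C_two_half : C (1/2 : ℚ) * 2 = 1 := by
  rw [← map_ofNat (C (R := ℚ)) 2, ← map_mul]; norm_num

theorem d_al : derivative ℚ al = C (1/2) * (expc 1 - 1) := by
  unfold al
  simp only [map_sub, Derivation.leibniz, d_C, d_e, derivative_X, smul_eq_mul,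
    Derivation.map_one_eq_zero]
  ring

theorem d_be : derivative ℚ be
    = 2 * expc 1 * al + C (1/2) * (expc 1 - 1) + expc 1 * (expc 1 - 1) := by
  unfold be al
  simp only [map_sub, Derivation.leibniz, d_C, d_e, derivative_X, smul_eq_mul, pow_two]
  linear_combination (-(expc 1 ^ 2 - X * expc 1)) * C_two_half

theorem d_ga : derivative ℚ ga
    = expc 1 * (al + be) + expc 1 * (expc 1 - 1) := by
  have h3 : C (1/3 : ℚ) * 3 = 1 := by
    rw [← map_ofNat (C (R := ℚ)) 3, ← map_mul]; norm_num
  have h4 : C (3/4 : ℚ) * 2 = C (1/2) + 1 := by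
    rw [← map_ofNat (C (R := ℚ)) 2, ← map_mul, ← map_one (C (R := ℚ)), ← map_add]; norm_num
  unfold ga be al
  simp only [map_sub, map_add, Derivation.leibniz, d_C, d_e, derivative_X, smul_eq_mul, pow_two,
    pow_succ, pow_zero, one_mul]
  linear_combination expc 1 ^ 3 * h3 + expc 1 ^ 2 * h4
    + (X * expc 1 + expc 1 - X * expc 1 ^ 2) * C_two_half

theorem d_sA (k : ℕ) : derivative ℚ (sA k) = C (k : ℚ) * sA k + sA (k+1) := by
  unfold sA
  simp only [Derivation.leibniz, d_pow, derivative_EE, smul_eq_mul]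
  ring

theorem d_sB (k : ℕ) : derivative ℚ (sB k) = C (k : ℚ) * sB k + sB (k+1) + sA (k+1) := by
  unfold sB sA
  simp only [map_sub, Derivation.leibniz, d_pow, derivative_EE, d_e, smul_eq_mul,
    Derivation.map_one_eq_zero]
  ring

theorem d_sC (k : ℕ) : derivative ℚ (sC k) = C (k : ℚ) * sC k + sC (k+1)
    + C ((k : ℚ) * (k + 1) / 2) * sB k + C ((k : ℚ) + 1) * sB (k+1) := by
  have hk : C ((k : ℚ) * (k + 1) / 2) = C (k : ℚ) * (C (k : ℚ) + 1) * C (1/2) := by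
    rw [← map_one (C (R := ℚ)), ← map_add, ← map_mul, ← map_mul]
    congr 1
    ring
  have hd : derivative ℚ (C (k : ℚ) ^ 2) = 0 := by rw [← map_pow]; exact d_C _
  rw [hk]
  unfold sC sB
  simp only [map_add, Derivation.leibniz, d_pow, derivative_EE, smul_eq_mul, hd, d_C,
    d_al, d_be, d_ga, Nat.cast_add, Nat.cast_one, map_one]
  ring

theorem ec_sA (m : ℕ) : ∀ k, ec (sA k) m = cA m k := by
  induction m with
  | zero => intro k; simp [ec_zero, sA, cA, constantCoeff_expc, constantCoeff_EE]
  | succ m ih =>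
    intro k
    rw [← ec_derivative, d_sA, ec_add, ec_C_mul, ih, ih, cA]

theorem ec_sB (m : ℕ) : ∀ k, ec (sB k) m = cB m k := by
  induction m with
  | zero => intro k; simp [ec_zero, sB, cB, constantCoeff_expc, constantCoeff_EE]
  | succ m ih =>
    intro k
    rw [← ec_derivative, d_sB, ec_add, ec_add, ec_C_mul, ih, ih, ec_sA, cB]

theorem ec_sC (m : ℕ) : ∀ k, ec (sC k) m = cC m k := by
  induction m with
  | zero =>
    intro k
    simp [ec_zero, sC, cC, constantCoeff_expc, constantCoeff_EE, al, be, ga]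
    norm_num
  | succ m ih =>
    intro k
    rw [← ec_derivative, d_sC, ec_add, ec_add, ec_add, ec_C_mul, ec_C_mul, ec_C_mul, ih, ih,
      ec_sB, ec_sB, cC]

/-- In `ℚ[[x]]`, the exponential generating function of the total
`srec` statistic over all set partitions satisfies
`Σ_{n≥0} (Σ_{π ∈ P_n} srec(π)) xⁿ/n!
  = exp(exp(x)-1) ((1/3)e^{3x} - (1/2)x e^{2x} + (3/4)e^{2x} - x eˣ - eˣ - 1/12)`,
where `expc c = Σ_{n≥0} cⁿxⁿ/n!` and `psExp (expc 1 - 1) = exp(exp(x)-1)`. -/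
theorem sum_elements_record_egf :
    PowerSeries.mk (fun n => (∑ π ∈ Pall n, srec π : ℚ) / n.factorial) =
      psExp (expc 1 - 1) *
        (PowerSeries.C (1/3 : ℚ) * expc 3 -
          PowerSeries.C (1/2 : ℚ) * (PowerSeries.X * expc 2) +
          PowerSeries.C (3/4 : ℚ) * expc 2 -
          PowerSeries.X * expc 1 - expc 1 - PowerSeries.C (1/12 : ℚ)) := by
  have e2 : expc 2 = expc 1 ^ 2 := by
    rw [pow_two, ← expc_add]; norm_num
  have e3 : expc 3 = expc 1 ^ 3 := by
    rw [pow_succ, ← e2, ← expc_add]; norm_num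
  have h : sC 0 = psExp (expc 1 - 1) *
        (PowerSeries.C (1/3 : ℚ) * expc 3 -
          PowerSeries.C (1/2 : ℚ) * (PowerSeries.X * expc 2) +
          PowerSeries.C (3/4 : ℚ) * expc 2 -
          PowerSeries.X * expc 1 - expc 1 - PowerSeries.C (1/12 : ℚ)) := by
    rw [e2, e3]
    simp [sC, ga, EE]
  rw [← h]
  ext n
  rw [coeff_mk, total_eq_cC, ← ec_sC, ec]
  have h3 : (n.factorial : ℚ) ≠ 0 := by positivity
  field_simp
end

section
/- In the ring of formal power series ℚ[[x]], exp(2x) · exp(exp(x) − 1) = Σ_{n≥0} (B_{n+2} − B_{n+1}) x^n/n!, where exp(cx) denotes the formal power series Σ_{n≥0} c^n x^n/n!. -/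
open Finset PowerSeries

lemma expc_one_eq : expc 1 = PowerSeries.exp ℚ := by
  ext n; simp [expc, PowerSeries.coeff_exp]

lemma expc_two_eq : expc 2 = expc 1 * expc 1 := by
  rw [expc_one_eq, ← pow_two, PowerSeries.exp_pow_eq_rescale_exp]
  ext n; simp [expc, PowerSeries.coeff_exp, div_eq_mul_inv]

lemma coeff_deriv_pow (n m : ℕ) :
    PowerSeries.coeff (n + 1) ((expc 1 - 1) ^ (m + 1)) * ((n : ℚ) + 1) =
      ((m : ℚ) + 1) * PowerSeries.coeff n (expc 1 * (expc 1 - 1) ^ m) := by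
  have hE : PowerSeries.derivative ℚ (expc 1) = expc 1 := by
    ext k
    rw [PowerSeries.coeff_derivative]
    simp only [expc, PowerSeries.coeff_mk, one_pow, Nat.factorial_succ]
    push_cast
    have : (k.factorial : ℚ) ≠ 0 := by positivity
    field_simp
  rw [← PowerSeries.coeff_derivative, Derivation.leibniz_pow]
  rw [map_sub, hE]
  simp only [Derivation.map_one_eq_zero, sub_zero, Nat.add_sub_cancel, smul_eq_mul]
  rw [map_nsmul, nsmul_eq_mul, mul_comm (expc 1)]
  push_cast
  rfl

lemma coeff_pow_eq (n m : ℕ) :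
    PowerSeries.coeff n ((expc 1 - 1) ^ m) = (m.factorial : ℚ) * stirling2 n m / n.factorial := by
  induction n generalizing m with
  | zero =>
    cases m with
    | zero => simp [stirling2]
    | succ m => simp [stirling2, expc_one_eq]
  | succ n ih =>
    cases m with
    | zero => simp [stirling2, PowerSeries.coeff_one]
    | succ m =>
      have h := coeff_deriv_pow n m
      have e : expc 1 * (expc 1 - 1) ^ m = (expc 1 - 1) ^ (m + 1) + (expc 1 - 1) ^ m := by ring
      rw [e, map_add, ih, ih] at h
      have h1 : (n.factorial : ℚ) ≠ 0 := by positivity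
      have h2 : (n : ℚ) + 1 ≠ 0 := by positivity
      rw [← mul_left_inj' h2, h]
      simp only [stirling2, Nat.factorial_succ]
      push_cast
      field_simp
      ring

lemma stirling2_zero_of_lt (n m : ℕ) (h : n < m) : stirling2 n m = 0 := by
  induction n generalizing m with
  | zero => cases m with
    | zero => omega
    | succ m => rfl
  | succ n ih => cases m with
    | zero => omega
    | succ m => simp [stirling2, ih m (by omega), ih (m + 1) (by omega)]

/-- Truncated exponential of `exp(x) - 1`. -/
noncomputable def truncF (N : ℕ) : PowerSeries ℚ :=
  ∑ m ∈ Finset.range N, PowerSeries.C (1 / (m.factorial : ℚ)) * (expc 1 - 1) ^ m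

lemma coeff_psExp (n N : ℕ) (h : n < N) :
    PowerSeries.coeff n (psExp (expc 1 - 1)) = PowerSeries.coeff n (truncF N) := by
  simp only [psExp, truncF, PowerSeries.coeff_mk, map_sum, PowerSeries.coeff_C_mul]
  rw [← Finset.sum_subset (Finset.range_mono (show n + 1 ≤ N by omega))]
  · exact Finset.sum_congr rfl fun m _ => by ring
  · intro m _ hm
    rw [coeff_pow_eq, stirling2_zero_of_lt n m (by simpa using hm)]
    simp

lemma coeff_psExp_bell (n : ℕ) :
    PowerSeries.coeff n (psExp (expc 1 - 1)) = (bell n : ℚ) / n.factorial := by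
  simp only [psExp, PowerSeries.coeff_mk, bell, coeff_pow_eq]
  push_cast
  rw [Finset.sum_div]
  refine Finset.sum_congr rfl fun m _ => ?_
  have h1 : (m.factorial : ℚ) ≠ 0 := by positivity
  field_simp

lemma deriv_psExp :
    PowerSeries.derivative ℚ (psExp (expc 1 - 1)) = expc 1 * psExp (expc 1 - 1) := by
  ext n
  have hR : PowerSeries.coeff n (expc 1 * psExp (expc 1 - 1)) =
      PowerSeries.coeff n (expc 1 * truncF (n + 1)) := by
    rw [PowerSeries.coeff_mul, PowerSeries.coeff_mul]
    refine Finset.sum_congr rfl fun p hp => ?_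
    rw [coeff_psExp p.2 (n + 1)]
    have := Finset.HasAntidiagonal.mem_antidiagonal.mp hp
    omega
  rw [hR, PowerSeries.coeff_derivative, coeff_psExp (n + 1) (n + 2) (by omega)]
  simp only [truncF, Finset.mul_sum, map_sum]
  rw [Finset.sum_range_succ', add_mul, Finset.sum_mul]
  have h0 : PowerSeries.coeff (n + 1)
      (PowerSeries.C (1 / ((Nat.factorial 0 : ℕ) : ℚ)) * (expc 1 - 1) ^ 0) = 0 := by
    rw [PowerSeries.coeff_C_mul]; simp [PowerSeries.coeff_one]
  rw [h0, zero_mul, add_zero]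
  refine Finset.sum_congr rfl fun m _ => ?_
  rw [mul_left_comm, PowerSeries.coeff_C_mul, PowerSeries.coeff_C_mul, mul_assoc, coeff_deriv_pow,
    Nat.factorial_succ]
  push_cast
  have h1 : (m.factorial : ℚ) ≠ 0 := by positivity
  field_simp

lemma deriv_expc_one : PowerSeries.derivative ℚ (expc 1) = expc 1 := by
  ext k
  rw [PowerSeries.coeff_derivative]
  simp only [expc, PowerSeries.coeff_mk, one_pow, Nat.factorial_succ]
  push_cast
  have : (k.factorial : ℚ) ≠ 0 := by positivity
  field_simp

/-- In `ℚ[[x]]`,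
`e^{2x} exp(eˣ - 1) = Σ_{n≥0} (B_{n+2} - B_{n+1}) xⁿ/n!`,
where `expc c = Σ_{n≥0} cⁿxⁿ/n!` and `psExp (expc 1 - 1) = exp(exp(x)-1)`. -/
theorem bell_egf_e2x :
    expc 2 * psExp (expc 1 - 1) =
      PowerSeries.mk (fun n => ((bell (n+2) : ℚ) - (bell (n+1) : ℚ)) / n.factorial) := by
  have key : expc 2 * psExp (expc 1 - 1) =
      PowerSeries.derivative ℚ (PowerSeries.derivative ℚ (psExp (expc 1 - 1))) -
        PowerSeries.derivative ℚ (psExp (expc 1 - 1)) := by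
    rw [deriv_psExp, Derivation.leibniz, deriv_psExp, deriv_expc_one, expc_two_eq]
    simp only [smul_eq_mul]
    ring
  rw [key]
  ext n
  rw [map_sub]
  simp only [PowerSeries.coeff_derivative, coeff_psExp_bell, PowerSeries.coeff_mk,
    Nat.factorial_succ]
  push_cast
  have : (n.factorial : ℚ) ≠ 0 := by positivity
  have h2 : (n : ℚ) + 1 + 1 ≠ 0 := by positivity
  field_simp
end
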